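/- arXiv:1806.07533 — 2 statements merged into one kernel-verified Lean document; each statement's English description precedes it below -/
import Mathlib

section
/- Fix a DEM iteration sequence: let (θ_t)_{t≥0} be a sequence in Θ, (μ_t)_{t≥0} a sequence of K-tuples of probability measures with μ_{t,k} on Y_k, and (U_{t+1})_{t≥0} subsets of {1,…,K}, such that for every t ≥ 0: (E step) μ_{t+1,k} = h_k(θ_t) for every k ∈ U_{t+1} and μ_{t+1,k} = μ_{t,k} for every k ∉ U_{t+1}; (M step) F(μ_{t+1}, θ_{t+1}) ≥ F(μ_{t+1}, θ_t); and KL(μ_{t,k} ‖ h_k(θ_t)) < ∞ for all t and k. Then the sequence F(μ_t, θ_t) is nondecreasing in t; in particular, if the sequence F(μ_t, θ_t) is bounded above, then it converges to some real limit F̂. -/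
open MeasureTheory Filter Topology

/-- Real-valued Kullback–Leibler divergence `∫ log(dμ/dν) dμ`. -/
noncomputable def klReal {α : Type*} [MeasurableSpace α] (μ ν : Measure α) : ℝ :=
  ∫ x, llr μ ν x ∂μ

/-- The KL divergence `KL(μ ‖ ν)` is finite: `μ ≪ ν` and the log-likelihood ratio is
`μ`-integrable. -/
def klFin {α : Type*} [MeasurableSpace α] (μ ν : Measure α) : Prop :=
  μ ≪ ν ∧ Integrable (llr μ ν) μ

/-- The free-energy functional `F(μ, θ) = ∑ k, (L_k(θ) − KL(μ_k ‖ h_k(θ)))`. -/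
noncomputable def freeEnergy {K : ℕ} {Θ : Type*} {Y : Fin K → Type*}
    [∀ k, MeasurableSpace (Y k)] (L : Fin K → Θ → ℝ)
    (h : Θ → ∀ k, Measure (Y k)) (μ : ∀ k, Measure (Y k)) (θ : Θ) : ℝ :=
  ∑ k : Fin K, (L k θ - klReal (μ k) (h θ k))

theorem klReal_self {α : Type*} [MeasurableSpace α] (μ : Measure α) [SigmaFinite μ] :
    klReal μ μ = 0 := by
  rw [klReal, integral_congr_ae (llr_self μ)]
  simp

theorem klReal_nonneg {α : Type*} [MeasurableSpace α] {μ ν : Measure α}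
    [IsProbabilityMeasure μ] [IsProbabilityMeasure ν] (hμν : klFin μ ν) : 0 ≤ klReal μ ν := by
  simpa [klReal] using
    InformationTheory.integral_llr_add_sub_measure_univ_nonneg hμν.1 hμν.2

/-- The sequence `F(μ_t, θ_t)` generated by DEM iterations is nondecreasing; in particular,
if it is bounded above then it converges to some real limit. -/
theorem dem_free_energy_monotone_and_converges
    {K : ℕ} (hK : 0 < K) {Θ : Type*} [Nonempty Θ]
    {Y : Fin K → Type*} [∀ k, MeasurableSpace (Y k)]
    (L : Fin K → Θ → ℝ) (h : Θ → ∀ k, Measure (Y k))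
    (hprob : ∀ θ k, IsProbabilityMeasure (h θ k))
    (θseq : ℕ → Θ) (μseq : ℕ → ∀ k, Measure (Y k))
    (hμprob : ∀ t k, IsProbabilityMeasure (μseq t k))
    (U : ℕ → Set (Fin K))
    (hE_update : ∀ t, ∀ k ∈ U t, μseq (t + 1) k = h (θseq t) k)
    (hE_keep : ∀ t, ∀ k ∉ U t, μseq (t + 1) k = μseq t k)
    (hM : ∀ t, freeEnergy L h (μseq (t + 1)) (θseq (t + 1)) ≥
      freeEnergy L h (μseq (t + 1)) (θseq t))
    (hfin : ∀ t k, klFin (μseq t k) (h (θseq t) k)) :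
    Monotone (fun t => freeEnergy L h (μseq t) (θseq t)) ∧
      (BddAbove (Set.range fun t => freeEnergy L h (μseq t) (θseq t)) →
        ∃ Fhat : ℝ,
          Tendsto (fun t => freeEnergy L h (μseq t) (θseq t)) atTop (𝓝 Fhat)) := by
  have hmono : Monotone (fun t => freeEnergy L h (μseq t) (θseq t)) := by
    refine monotone_nat_of_le_succ fun t => le_trans ?_ (hM t)
    refine Finset.sum_le_sum fun k _ => sub_le_sub_left ?_ _
    have := hprob (θseq t) k
    have := hμprob t k
    by_cases hk : k ∈ U t
    · rw [hE_update t k hk, klReal_self]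
      exact klReal_nonneg (hfin t k)
    · rw [hE_keep t k hk]
  exact ⟨hmono, fun hbdd => ⟨_, tendsto_atTop_ciSup hmono hbdd⟩⟩
end

section
/- Let A and B be n×n real symmetric positive definite matrices and P and Q be n×n real symmetric positive semidefinite matrices, and suppose A, B, P, Q pairwise commute. Define S_EM = (A + B)⁻¹ (P + Q), S_DEM = A⁻¹ P, C = A⁻¹ B, and O = (A + B)⁻¹ Q (all of which are then symmetric positive semidefinite). Then S_EM = (I + C)⁻¹ S_DEM + O and λ_min(S_EM) ≥ λ_min(S_DEM) / (1 + λ_max(C)) + λ_min(O), where λ_min and λ_max denote the smallest and largest eigenvalues. -/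
open scoped MatrixOrder in
theorem Matrix.PosSemidef.mul_of_commute {ι : Type*} [Fintype ι] [DecidableEq ι]
    {M N : Matrix ι ι ℝ} (hM : M.PosSemidef) (hN : N.PosSemidef) (h : Commute M N) : (M * N).PosSemidef :=
  Matrix.nonneg_iff_posSemidef.mp (Commute.mul_nonneg hM.nonneg hN.nonneg h)

theorem Matrix.commute_nonsing_inv_left {ι : Type*} [Fintype ι] [DecidableEq ι]
    {M N : Matrix ι ι ℝ} (h : Commute M N) : Commute M⁻¹ N := by
  simpa only [Matrix.zpow_neg_one] using Matrix.Commute.zpow_left h (-1)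

open scoped MatrixOrder in
theorem Matrix.IsHermitian.posSemidef_sub_smul_one_iff {ι : Type*} [Fintype ι] [DecidableEq ι]
    {M : Matrix ι ι ℝ} (hM : M.IsHermitian) (r : ℝ) :
    (M - r • (1 : Matrix ι ι ℝ)).PosSemidef ↔ ∀ x ∈ spectrum ℝ M, r ≤ x := by
  rw [← algebraMap_le_iff_le_spectrum (a := M) hM.isSelfAdjoint, Matrix.le_iff,
    Algebra.algebraMap_eq_smul_one]

open scoped MatrixOrder in
theorem Matrix.IsHermitian.posSemidef_smul_one_sub_iff {ι : Type*} [Fintype ι] [DecidableEq ι]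
    {M : Matrix ι ι ℝ} (hM : M.IsHermitian) (r : ℝ) :
    (r • (1 : Matrix ι ι ℝ) - M).PosSemidef ↔ ∀ x ∈ spectrum ℝ M, x ≤ r := by
  rw [← le_algebraMap_iff_spectrum_le (a := M) hM.isSelfAdjoint, Matrix.le_iff,
    Algebra.algebraMap_eq_smul_one]

theorem Matrix.PosSemidef.nonneg_of_mem_spectrum {ι : Type*} [Fintype ι] [DecidableEq ι]
    {M : Matrix ι ι ℝ} (hM : M.PosSemidef) {x : ℝ} (hx : x ∈ spectrum ℝ M) : 0 ≤ x :=
  (Matrix.posSemidef_iff_isHermitian_and_spectrum_nonneg.mp hM).2 hx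

/-- DEM vs EM global speed bound: for commuting symmetric `A, B ≻ 0` and `P, Q ⪰ 0`, the
speed matrices `S_EM = (A+B)⁻¹(P+Q)`, `S_DEM = A⁻¹P`, `C = A⁻¹B`, `O = (A+B)⁻¹Q` are all
symmetric positive semidefinite, satisfy `S_EM = (I + C)⁻¹ S_DEM + O`, and
`λ_min(S_EM) ≥ λ_min(S_DEM)/(1 + λ_max(C)) + λ_min(O)`, where `λ_min`/`λ_max` are the
smallest/largest eigenvalues (here `sInf`/`sSup` of the real spectrum). -/
theorem dem_em_global_speed_bound
    {n : ℕ} (A B P Q : Matrix (Fin n) (Fin n) ℝ)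
    (hA : A.PosDef) (hB : B.PosDef) (hP : P.PosSemidef) (hQ : Q.PosSemidef)
    (hAB : A * B = B * A) (hAP : A * P = P * A) (hAQ : A * Q = Q * A)
    (hBP : B * P = P * B) (hBQ : B * Q = Q * B) (hPQ : P * Q = Q * P)
    (SEM SDEM C O : Matrix (Fin n) (Fin n) ℝ)
    (hSEM : SEM = (A + B)⁻¹ * (P + Q)) (hSDEM : SDEM = A⁻¹ * P)
    (hC : C = A⁻¹ * B) (hO : O = (A + B)⁻¹ * Q) :
    SEM.PosSemidef ∧ SDEM.PosSemidef ∧ C.PosSemidef ∧ O.PosSemidef ∧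
      SEM = (1 + C)⁻¹ * SDEM + O ∧
      sInf (spectrum ℝ SEM) ≥
        sInf (spectrum ℝ SDEM) / (1 + sSup (spectrum ℝ C)) + sInf (spectrum ℝ O) := by
  have hKdef : (A + B).PosDef := hA.add hB
  have hAinv : A * A⁻¹ = 1 := Matrix.mul_nonsing_inv A (A.isUnit_iff_isUnit_det.mp hA.isUnit)
  have hKdet : IsUnit (A + B).det := (A + B).isUnit_iff_isUnit_det.mp hKdef.isUnit
  have hKinv : (A + B)⁻¹ * (A + B) = 1 := Matrix.nonsing_inv_mul _ hKdet
  have cKP : Commute (A + B) P := Commute.add_left hAP hBP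
  have cKQ : Commute (A + B) Q := Commute.add_left hAQ hBQ
  have cKA : Commute (A + B) A := Commute.add_left rfl hAB.symm
  have cKB : Commute (A + B) B := Commute.add_left hAB rfl
  have pE : SEM.PosSemidef := hSEM ▸ hKdef.posSemidef.inv.mul_of_commute (hP.add hQ)
    (Matrix.commute_nonsing_inv_left (cKP.add_right cKQ))
  have pD : SDEM.PosSemidef := hSDEM ▸ hA.posSemidef.inv.mul_of_commute hP
    (Matrix.commute_nonsing_inv_left hAP)
  have pC : C.PosSemidef := hC ▸ hA.posSemidef.inv.mul_of_commute hB.posSemidef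
    (Matrix.commute_nonsing_inv_left hAB)
  have pO : O.PosSemidef := hO ▸ hKdef.posSemidef.inv.mul_of_commute hQ
    (Matrix.commute_nonsing_inv_left cKQ)
  have cAD : Commute A SDEM := hSDEM ▸
    (Matrix.commute_nonsing_inv_left (Commute.refl A)).symm.mul_right hAP
  have cAC : Commute A C := hC ▸
    (Matrix.commute_nonsing_inv_left (Commute.refl A)).symm.mul_right hAB
  have eD : A * SDEM = P := by rw [hSDEM, ← mul_assoc, hAinv, one_mul]
  have eC : A * C = B := by rw [hC, ← mul_assoc, hAinv, one_mul]
  have hfac : A + B = A * (1 + C) := by rw [mul_add, mul_one, eC]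
  refine ⟨pE, pD, pC, pO, ?_, ?_⟩
  · rw [hSEM, hO, mul_add, hSDEM, ← mul_assoc, ← Matrix.mul_inv_rev, ← hfac]
  rcases Nat.eq_zero_or_pos n with rfl | hn
  · simp [spectrum.of_subsingleton]
  have : NeZero n := ⟨hn.ne'⟩
  have hne : (spectrum ℝ SEM).Nonempty :=
    ContinuousFunctionalCalculus.spectrum_nonempty SEM pE.isHermitian.isSelfAdjoint
  set a := sInf (spectrum ℝ SDEM)
  set c := sSup (spectrum ℝ C)
  set o := sInf (spectrum ℝ O)
  have ha : 0 ≤ a := Real.sInf_nonneg fun _ hx => pD.nonneg_of_mem_spectrum hx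
  have hc : 0 ≤ c := Real.sSup_nonneg fun _ hx => pC.nonneg_of_mem_spectrum hx
  have hD : (P - a • A).PosSemidef := by
    have h := hA.posSemidef.mul_of_commute
      ((pD.isHermitian.posSemidef_sub_smul_one_iff a).mpr fun x hx =>
        csInf_le SDEM.finite_real_spectrum.bddBelow hx)
      (cAD.sub_right ((Commute.one_right A).smul_right a))
    rwa [mul_sub, eD, mul_smul_comm, mul_one] at h
  have hcA : (c • A - B).PosSemidef := by
    have h := hA.posSemidef.mul_of_commute
      ((pC.isHermitian.posSemidef_smul_one_sub_iff c).mpr fun x hx =>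
        le_csSup C.finite_real_spectrum.bddAbove hx)
      (((Commute.one_right A).smul_right c).sub_right cAC)
    rwa [mul_sub, eC, mul_smul_comm, mul_one] at h
  have hOo : (O - o • (1 : Matrix (Fin n) (Fin n) ℝ)).PosSemidef :=
    (pO.isHermitian.posSemidef_sub_smul_one_iff o).mpr fun x hx =>
      csInf_le O.finite_real_spectrum.bddBelow hx
  have hsum : ((P - a • A) + (a / (1 + c)) • (c • A - B)).PosSemidef :=
    hD.add (hcA.smul (by positivity))
  have hprod := hKdef.posSemidef.inv.mul_of_commute hsum
    (Matrix.commute_nonsing_inv_left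
      ((cKP.sub_right (cKA.smul_right a)).add_right
        (((cKA.smul_right c).sub_right cKB).smul_right (a / (1 + c)))))
  have hdecomp : (P - a • A) + (a / (1 + c)) • (c • A - B) = P - (a / (1 + c)) • (A + B) := by
    have h : a = a / (1 + c) + a / (1 + c) * c := by field_simp
    generalize a / (1 + c) = t at h ⊢
    rw [h]
    module
  rw [hdecomp, mul_sub, mul_smul_comm, hKinv] at hprod
  refine le_csInf hne ((pE.isHermitian.posSemidef_sub_smul_one_iff _).mp ?_)
  have hfin := hprod.add hOo
  convert hfin using 1
  rw [hSEM, hO, mul_add]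
  module
end
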